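/- Let (A,B,C) and (Ã,B̃,C̃) be admissible triples of real numbers with A·B̃ ≠ Ã·B, and let w be a C^∞ nondegenerate solution of the (A,B,C)-equation on an open neighborhood U of the origin in ℝ³. Then there exist an open neighborhood V ⊆ U of the origin and a C^∞ nondegenerate function v : V → ℝ such that the pair (w,v) satisfies the Bäcklund system on V; in particular v satisfies the (Ã,B̃,C̃)-equation on V. (Theorem 5.50, part 4: existence of a Bäcklund–Darboux partner.) -/

import Mathlib

noncomputable section

/-- ℝ³ as a Euclidean space. -/
abbrev R3 := EuclideanSpace ℝ (Fin 3)

/-- Partial derivative of `f` in the `i`-th coordinate direction. -/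
def pd (i : Fin 3) (f : R3 → ℝ) (p : R3) : ℝ :=
  fderiv ℝ f p (EuclideanSpace.single i 1)

/-- A triple (A,B,C) is admissible if all entries are nonzero and they sum to zero. -/
def Admissible (A B C : ℝ) : Prop := A ≠ 0 ∧ B ≠ 0 ∧ C ≠ 0 ∧ A + B + C = 0

/-- `f` is nondegenerate on `U` : all three first partials vanish nowhere on `U`. -/
def Nondeg (f : R3 → ℝ) (U : Set R3) : Prop :=
  ∀ p ∈ U, pd 0 f p ≠ 0 ∧ pd 1 f p ≠ 0 ∧ pd 2 f p ≠ 0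

/-- The Bäcklund system (5.60) for the pair (w,v) on `U`. -/
def Backlund (A B C A' B' C' : ℝ) (w v : R3 → ℝ) (U : Set R3) : Prop :=
  ∀ p ∈ U,
    A * B' * pd 0 w p * pd 1 v p = A' * B * pd 1 w p * pd 0 v p ∧
    A * C' * pd 0 w p * pd 2 v p = A' * C * pd 2 w p * pd 0 v p

/-- `w` satisfies the (A,B,C)-equation `A·w_x·w_{yz} + B·w_y·w_{xz} + C·w_z·w_{xy} = 0` on `U`. -/
def ABCEq (A B C : ℝ) (w : R3 → ℝ) (U : Set R3) : Prop :=
  ∀ p ∈ U,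
    A * pd 0 w p * pd 1 (pd 2 w) p + B * pd 1 w p * pd 0 (pd 2 w) p
      + C * pd 2 w p * pd 0 (pd 1 w) p = 0

open Set Filter Topology

section NemytskiiOperator

universe u

variable {X : Type*} [TopologicalSpace X] [CompactSpace X]
  {E F : Type u} [NormedAddCommGroup E] [NormedSpace ℝ E] [NormedAddCommGroup F] [NormedSpace ℝ F]

/-- Pointwise application of a continuous family of operators to a continuous map. -/
def ptApply (X : Type*) [TopologicalSpace X] [CompactSpace X] (E F : Type u)
    [NormedAddCommGroup E] [NormedSpace ℝ E] [NormedAddCommGroup F] [NormedSpace ℝ F] :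
    C(X, E →L[ℝ] F) →L[ℝ] C(X, E) →L[ℝ] C(X, F) :=
  LinearMap.mkContinuous₂
    (LinearMap.mk₂ ℝ (fun (A : C(X, E →L[ℝ] F)) (h : C(X, E)) =>
        (⟨fun x => A x (h x), by fun_prop⟩ : C(X, F)))
      (fun _ _ _ => by ext; simp) (fun _ _ _ => by ext; simp)
      (fun _ _ _ => by ext; simp) (fun _ _ _ => by ext; simp)) 1
    (fun A h => by
      rw [one_mul, ContinuousMap.norm_le _ (by positivity)]
      exact fun x => (A x).le_of_opNorm_le_of_le (A.norm_coe_le_norm x) (h.norm_coe_le_norm x))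

theorem hasFDerivAt_comp_left (f : C(E, F)) (f' : C(E, E →L[ℝ] F))
    (hf : ∀ x, HasFDerivAt f (f' x) x) (u : C(X, E)) :
    HasFDerivAt (fun u : C(X, E) => f.comp u) (ptApply X E F (f'.comp u)) u := by
  rw [hasFDerivAt_iff_isLittleO_nhds_zero, Asymptotics.isLittleO_iff]
  intro c hc
  have hK : IsCompact (range u) := isCompact_range u.continuous
  have := hK.uniformContinuousAt_of_continuousAt f'
    (fun a _ => f'.continuous.continuousAt) (Metric.dist_mem_uniformity hc)
  obtain ⟨δ, hδ, hδ'⟩ := Metric.mem_uniformity_dist.1 this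
  filter_upwards [Metric.ball_mem_nhds (0 : C(X, E)) hδ] with h hh
  rw [mem_ball_zero_iff] at hh
  rw [ContinuousMap.norm_le _ (by positivity)]
  intro x
  have hx : ‖h x‖ ≤ ‖h‖ := h.norm_coe_le_norm x
  have key := (convex_ball (u x) δ).norm_image_sub_le_of_norm_hasFDerivWithin_le'
    (f := f) (f' := f') (φ := f' (u x)) (C := c) (x := u x) (y := u x + h x)
    (fun y _ => (hf y).hasFDerivWithinAt)
    (fun y hy => by
      have := @hδ' (u x) y (by rwa [dist_comm]) (mem_range_self x)
      rw [← dist_eq_norm, dist_comm]; exact le_of_lt this)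
    (Metric.mem_ball_self hδ)
    (by rw [mem_ball_iff_norm, add_sub_cancel_left]; exact hx.trans_lt hh)
  simp only [add_sub_cancel_left] at key
  exact key.trans (mul_le_mul_of_nonneg_left hx hc.le)

theorem contDiff_nat_comp_left (n : ℕ) : ∀ {F : Type u} [NormedAddCommGroup F] [NormedSpace ℝ F]
    (f : C(E, F)), ContDiff ℝ n f → ContDiff ℝ n (fun u : C(X, E) => f.comp u) := by
  induction n with
  | zero =>
    intro F _ _ f _
    exact contDiff_zero.2 f.continuous_postcomp
  | succ n ih =>
    intro F _ _ f hf
    push_cast at hf ⊢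
    obtain ⟨f', hf', hd⟩ := contDiff_succ_iff_hasFDerivAt.1 hf
    refine contDiff_succ_iff_hasFDerivAt.2
      ⟨_, (ptApply X E F).contDiff.comp (ih ⟨f', hf'.continuous⟩ hf'), fun u => ?_⟩
    exact hasFDerivAt_comp_left f ⟨f', hf'.continuous⟩ hd u

/-- Left composition with a smooth map is smooth on the space of continuous maps. -/
theorem contDiff_comp_left (f : C(E, F)) (hf : ContDiff ℝ (⊤ : ℕ∞) f) :
    ContDiff ℝ (⊤ : ℕ∞) (fun u : C(X, E) => f.comp u) :=
  contDiff_infty.2 fun n => contDiff_nat_comp_left n f (contDiff_infty.1 hf n)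

end NemytskiiOperator

/-- A smooth version of the implicit function theorem, in which the implicit function is smooth on a
whole neighbourhood of the base point. -/
theorem exists_implicit_of_fderiv_inr_eq_id {P W : Type*}
    [NormedAddCommGroup P] [NormedSpace ℝ P] [CompleteSpace P]
    [NormedAddCommGroup W] [NormedSpace ℝ W] [CompleteSpace W]
    {Φ : P × W → W} (hΦ : ContDiff ℝ (⊤ : ℕ∞) Φ) (h0 : Φ 0 = 0)
    (hid : ∀ h, fderiv ℝ Φ 0 (0, h) = h) :
    ∃ ψ : P → W, ψ 0 = 0 ∧ ∀ᶠ p in 𝓝 0, ContDiffAt ℝ (⊤ : ℕ∞) ψ p ∧ Φ (p, ψ p) = 0 := by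
  set Ψ : P × W → P × W := fun q => (q.1, Φ q)
  have hΨ : ContDiff ℝ (⊤ : ℕ∞) Ψ := contDiff_fst.prodMk hΦ
  have htop : ((⊤ : ℕ∞) : WithTop ℕ∞) ≠ 0 := by simp
  let D : (P × W) ≃L[ℝ] (P × W) :=
    (ContinuousLinearEquiv.refl ℝ P).skewProd (ContinuousLinearEquiv.refl ℝ W)
      (fderiv ℝ Φ 0 ∘L .inl ℝ P W)
  have hD : HasFDerivAt Ψ (D : (P × W) →L[ℝ] (P × W)) 0 := by
    have h1 := (hasFDerivAt_fst (𝕜 := ℝ) (p := (0 : P × W))).prodMk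
      (hΦ.differentiable htop 0).hasFDerivAt
    have h2 : (D : (P × W) →L[ℝ] (P × W)) =
        (ContinuousLinearMap.fst ℝ P W).prod (fderiv ℝ Φ 0) := by
      refine ContinuousLinearMap.ext fun x => Prod.ext (by simp [D]) ?_
      have h3 : fderiv ℝ Φ 0 x = fderiv ℝ Φ 0 (x.1, 0) + fderiv ℝ Φ 0 (0, x.2) := by
        rw [← map_add]; simp
      simp [D, h3, hid, add_comm]
    rw [h2]
    exact h1
  set e := (hΨ.contDiffAt (x := 0)).toOpenPartialHomeomorph Ψ hD htop
  have he : ∀ q, e q = Ψ q := fun q => rfl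
  have hs : (0 : P × W) ∈ e.source :=
    (hΨ.contDiffAt (x := 0)).mem_toOpenPartialHomeomorph_source hD htop
  have hΨ0 : Ψ 0 = 0 := by simp [Ψ, h0]
  have ht : (0 : P × W) ∈ e.target := by
    have := e.map_source hs
    rwa [he, hΨ0] at this
  have hsymm : e.symm 0 = 0 := by
    have := e.left_inv hs
    rwa [he, hΨ0] at this
  have hcont : ContinuousAt e.symm 0 := e.symm.continuousAt ht
  have hι : ContinuousAt (fun p : P => (p, (0 : W))) 0 := by fun_prop
  have hopen : ∀ᶠ q in 𝓝 (0 : P × W), ∃ D' : (P × W) ≃L[ℝ] (P × W),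
      (D' : (P × W) →L[ℝ] (P × W)) = fderiv ℝ Ψ q := by
    have hc : ContinuousAt (fderiv ℝ Ψ) 0 := (hΨ.continuous_fderiv htop).continuousAt
    exact hc.eventually (ContinuousLinearEquiv.isOpen.mem_nhds ⟨D, hD.fderiv.symm⟩)
  have hev : ∀ᶠ q in 𝓝 (0 : P × W), q ∈ e.target ∧
      ∃ D' : (P × W) ≃L[ℝ] (P × W), (D' : (P × W) →L[ℝ] (P × W)) = fderiv ℝ Ψ (e.symm q) := by
    rw [← hsymm] at hopen
    exact (e.open_target.eventually_mem ht).and (hcont.eventually hopen)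
  refine ⟨fun p => (e.symm (p, 0)).2, by simp [← Prod.zero_eq_mk, hsymm], ?_⟩
  filter_upwards [hι.eventually hev] with p hp
  obtain ⟨hpt, D', hD'⟩ := hp
  constructor
  · have h1 : ContDiffAt ℝ (⊤ : ℕ∞) e.symm (p, 0) := by
      refine e.contDiffAt_symm hpt (f₀' := D') ?_ hΨ.contDiffAt
      rw [hD']
      exact (hΨ.differentiable htop _).hasFDerivAt
    exact contDiffAt_snd.comp p (h1.comp p (contDiffAt_id.prodMk contDiffAt_const))
  · have h1 := e.right_inv hpt
    rw [he] at h1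
    have h2 : (e.symm (p, 0)).1 = p := congrArg Prod.fst h1
    have h3 : Φ (e.symm (p, 0)) = 0 := congrArg Prod.snd h1
    have h4 : (p, (e.symm (p, 0)).2) = e.symm (p, 0) := Prod.ext h2.symm rfl
    rw [h4, h3]

section Primitive

open scoped unitInterval

/-- The projection of the real line onto the unit interval. -/
abbrev clamp (t : ℝ) : I := projIcc 0 1 zero_le_one t

theorem continuous_clamp : Continuous clamp := continuous_projIcc

/-- The primitive vanishing at `0` of a continuous function on the unit interval. -/
def primitive : C(I, ℝ) →L[ℝ] C(I, ℝ) :=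
  LinearMap.mkContinuous
    { toFun := fun f => ⟨fun s => ∫ τ in (0 : ℝ)..s, f (clamp τ),
        (intervalIntegral.continuous_primitive (fun _ _ =>
          (f.continuous.comp continuous_clamp).intervalIntegrable _ _) 0).comp
            continuous_subtype_val⟩
      map_add' := fun f g => by
        ext s
        exact intervalIntegral.integral_add
          ((f.continuous.comp continuous_clamp).intervalIntegrable _ _)
          ((g.continuous.comp continuous_clamp).intervalIntegrable _ _)
      map_smul' := fun c f => by
        ext s
        exact intervalIntegral.integral_smul c _ } 1
    (fun f => by
      rw [one_mul, ContinuousMap.norm_le _ (by positivity)]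
      intro s
      have h1 := intervalIntegral.norm_integral_le_of_norm_le_const (a := 0) (b := (s : ℝ))
        (f := fun τ => f (clamp τ)) (C := ‖f‖) (fun τ _ => f.norm_coe_le_norm _)
      refine h1.trans ?_
      rw [sub_zero, abs_of_nonneg s.2.1]
      exact mul_le_of_le_one_right (norm_nonneg _) s.2.2)

theorem primitive_apply (f : C(I, ℝ)) (s : I) :
    primitive f s = ∫ τ in (0 : ℝ)..s, f (clamp τ) := rfl

theorem primitive_apply_clamp_zero (f : C(I, ℝ)) : primitive f (clamp 0) = 0 := by
  simp [primitive_apply, clamp]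

theorem hasDerivWithinAt_primitive (f : C(I, ℝ)) {t : ℝ} (ht : t ∈ Ico (0 : ℝ) 1) :
    HasDerivWithinAt (fun t => primitive f (clamp t)) (f (clamp t)) (Ici t) t := by
  have hc : Continuous fun τ => f (clamp τ) := f.continuous.comp continuous_clamp
  have h1 : HasDerivAt (fun s => ∫ τ in (0 : ℝ)..s, f (clamp τ)) (f (clamp t)) t :=
    intervalIntegral.integral_hasDerivAt_right (hc.intervalIntegrable _ _)
      hc.aestronglyMeasurable.stronglyMeasurableAtFilter hc.continuousAt
  refine h1.hasDerivWithinAt.congr_of_eventuallyEq ?_ ?_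
  · filter_upwards [Icc_mem_nhdsGE ht.2] with s hs
    rw [primitive_apply, clamp, projIcc_of_mem _ ⟨ht.1.trans hs.1, hs.2⟩]
  · rw [primitive_apply, clamp, projIcc_of_mem _ ⟨ht.1, ht.2.le⟩]

theorem hasDerivWithinAt_clamp {t : ℝ} (ht : t ∈ Ico (0 : ℝ) 1) :
    HasDerivWithinAt (fun t => (clamp t : ℝ)) 1 (Ici t) t := by
  refine (hasDerivWithinAt_id t _).congr_of_eventuallyEq ?_ ?_
  · filter_upwards [Icc_mem_nhdsGE ht.2] with s hs
    rw [clamp, projIcc_of_mem _ ⟨ht.1.trans hs.1, hs.2⟩, id]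
  · rw [clamp, projIcc_of_mem _ ⟨ht.1, ht.2.le⟩, id]

end Primitive

section PartialDerivatives

/-- The `i`-th coordinate vector of `R3`. -/
abbrev basisVec (i : Fin 3) : R3 := EuclideanSpace.single i 1

theorem eq_sum_basisVec (x : R3) :
    x = x 0 • basisVec 0 + x 1 • basisVec 1 + x 2 • basisVec 2 := by
  ext i
  fin_cases i <;> simp [basisVec]

theorem fderiv_apply_eq_pd (f : R3 → ℝ) (p x : R3) :
    fderiv ℝ f p x = x 0 * pd 0 f p + x 1 * pd 1 f p + x 2 * pd 2 f p := by
  conv_lhs => rw [eq_sum_basisVec x]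
  simp [pd, basisVec]

theorem hasFDerivAt_coord (i : Fin 3) (p : R3) :
    HasFDerivAt (fun p : R3 => p i) (EuclideanSpace.proj i : R3 →L[ℝ] ℝ) p :=
  (EuclideanSpace.proj i : R3 →L[ℝ] ℝ).hasFDerivAt

theorem contDiff_coord (i : Fin 3) {n : WithTop ℕ∞} : ContDiff ℝ n (fun p : R3 => p i) :=
  (EuclideanSpace.proj i : R3 →L[ℝ] ℝ).contDiff

end PartialDerivatives

section LeafCurves

open scoped unitInterval

/-- The curve `s ↦ (x + u s, (1 - s) y, (1 - s) z)` attached to a point `(x, y, z)` and a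
displacement `u`. -/
def leafCurve : R3 × C(I, ℝ) →L[ℝ] C(I, R3) :=
  (LinearMap.toContinuousLinearMap
    { toFun := fun p : R3 => (⟨fun s : I => p - (s : ℝ) • (p - p 0 • basisVec 0), by fun_prop⟩ :
        C(I, R3))
      map_add' := fun p q => by
        ext s i
        simp
        split_ifs <;> ring
      map_smul' := fun c p => by
        ext s i
        simp
        split_ifs <;> ring }) ∘L ContinuousLinearMap.fst ℝ R3 C(I, ℝ) +
  ((ContinuousLinearMap.toSpanSingleton ℝ (basisVec 0)).compLeftContinuous ℝ I) ∘L
    ContinuousLinearMap.snd ℝ R3 C(I, ℝ)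

theorem leafCurve_apply (p : R3) (u : C(I, ℝ)) (s : I) :
    leafCurve (p, u) s = p - (s : ℝ) • (p - p 0 • basisVec 0) + u s • basisVec 0 := rfl

theorem leafCurve_apply_zero (p : R3) (u : C(I, ℝ)) (s : I) :
    leafCurve (p, u) s 0 = p 0 + u s := by
  simp [leafCurve_apply]

theorem leafCurve_apply_one (p : R3) (u : C(I, ℝ)) (s : I) :
    leafCurve (p, u) s 1 = (1 - s) * p 1 := by
  simp [leafCurve_apply]; ring

theorem leafCurve_apply_two (p : R3) (u : C(I, ℝ)) (s : I) :
    leafCurve (p, u) s 2 = (1 - s) * p 2 := by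
  simp [leafCurve_apply]; ring

/-- The integral operator whose zeros `(p, u)` are the curves from `p` tangent to the distribution
spanned by `∂_y - a ∂_x` and `∂_z - b ∂_x`. -/
def leafDefect (a b : C(R3, ℝ)) (q : R3 × C(I, ℝ)) : C(I, ℝ) :=
  q.2 - (q.1 1 • primitive (a.comp (leafCurve q)) + q.1 2 • primitive (b.comp (leafCurve q)))

theorem contDiff_leafDefect {a b : C(R3, ℝ)} (ha : ContDiff ℝ (⊤ : ℕ∞) a)
    (hb : ContDiff ℝ (⊤ : ℕ∞) b) : ContDiff ℝ (⊤ : ℕ∞) (leafDefect a b) := by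
  have h (f : C(R3, ℝ)) (hf : ContDiff ℝ (⊤ : ℕ∞) f) :
      ContDiff ℝ (⊤ : ℕ∞) (fun q => primitive (f.comp (leafCurve q))) :=
    primitive.contDiff.comp ((contDiff_comp_left f hf).comp leafCurve.contDiff)
  exact contDiff_snd.sub ((((contDiff_coord 1).comp contDiff_fst).smul (h a ha)).add
    (((contDiff_coord 2).comp contDiff_fst).smul (h b hb)))

/-- The derivative of a smooth function, as a continuous map. -/
def contFDeriv (a : C(R3, ℝ)) (ha : ContDiff ℝ (⊤ : ℕ∞) a) : C(R3, R3 →L[ℝ] ℝ) :=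
  ⟨fderiv ℝ a, ha.continuous_fderiv (by simp)⟩

theorem fderiv_leafDefect {a b : C(R3, ℝ)} (ha : ContDiff ℝ (⊤ : ℕ∞) a)
    (hb : ContDiff ℝ (⊤ : ℕ∞) b) (p ξ : R3) (u h : C(I, ℝ)) :
    fderiv ℝ (leafDefect a b) (p, u) (ξ, h) = h -
      primitive (ξ 1 • a.comp (leafCurve (p, u)) + ξ 2 • b.comp (leafCurve (p, u)) +
        p 1 • ptApply I R3 ℝ ((contFDeriv a ha).comp (leafCurve (p, u))) (leafCurve (ξ, h)) +
        p 2 • ptApply I R3 ℝ ((contFDeriv b hb).comp (leafCurve (p, u))) (leafCurve (ξ, h))) := by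
  have hf (f : C(R3, ℝ)) (h_smooth : ContDiff ℝ (⊤ : ℕ∞) f) :
      HasFDerivAt (fun q => primitive (f.comp (leafCurve q)))
        (primitive ∘L ptApply I R3 ℝ ((contFDeriv f h_smooth).comp (leafCurve (p, u))) ∘L leafCurve)
        (p, u) :=
    primitive.hasFDerivAt.comp (p, u) ((hasFDerivAt_comp_left f (contFDeriv f h_smooth)
      (fun x => (h_smooth.differentiable (by simp) x).hasFDerivAt) (leafCurve (p, u))).comp (p, u)
        leafCurve.hasFDerivAt)
  have hc (i : Fin 3) : HasFDerivAt (fun q : R3 × C(I, ℝ) => q.1 i)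
      ((EuclideanSpace.proj i : R3 →L[ℝ] ℝ) ∘L ContinuousLinearMap.fst ℝ R3 C(I, ℝ)) (p, u) :=
    ((EuclideanSpace.proj i : R3 →L[ℝ] ℝ) ∘L ContinuousLinearMap.fst ℝ R3 C(I, ℝ)).hasFDerivAt
  have key := hasFDerivAt_snd.sub (((hc 1).smul (hf a ha)).add ((hc 2).smul (hf b hb)))
  have : HasFDerivAt (leafDefect a b) _ (p, u) := key
  rw [this.fderiv]
  simp only [map_add, map_smul]
  simp
  abel

theorem leafDefect_zero (a b : C(R3, ℝ)) : leafDefect a b 0 = 0 := by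
  simp [leafDefect]

/-- Displacing the base point of a leaf curve along the distribution does not move its endpoint. -/
theorem endpoint_variation_eq {a b : C(R3, ℝ)} (ha : ContDiff ℝ (⊤ : ℕ∞) a)
    (hb : ContDiff ℝ (⊤ : ℕ∞) b) {p ξ : R3} {u h : C(I, ℝ)}
    (hu : leafDefect a b (p, u) = 0)
    (hh : fderiv ℝ (leafDefect a b) (p, u) (ξ, h) = 0)
    (hξ : ξ 0 = -(ξ 1 * a p + ξ 2 * b p))
    (hint : ∀ s, pd 1 b (leafCurve (p, u) s) -
        a (leafCurve (p, u) s) * pd 0 b (leafCurve (p, u) s) =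
      pd 2 a (leafCurve (p, u) s) - b (leafCurve (p, u) s) * pd 0 a (leafCurve (p, u) s)) :
    h 1 = -ξ 0 := by
  set γ : ℝ → R3 := fun t => leafCurve (p, u) (clamp t) with hγ
  set g : ℝ → ℝ := fun t => p 1 * a (γ t) + p 2 * b (γ t) with hg
  set l : ℝ → ℝ := fun t => p 1 * pd 0 a (γ t) + p 2 * pd 0 b (γ t) with hl
  set f : ℝ → ℝ := fun t => ξ 1 * a (γ t) + ξ 2 * b (γ t) with hf
  set m : ℝ → ℝ := fun t => h (clamp t) + ξ 0 + (1 - (clamp t : ℝ)) * f t with hm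
  have hγc : Continuous γ := (leafCurve (p, u)).continuous.comp continuous_clamp
  have hlc : Continuous l := by
    have h1 (c : C(R3, ℝ)) (hc : ContDiff ℝ (⊤ : ℕ∞) c) : Continuous fun t => pd 0 c (γ t) :=
      (((hc.continuous_fderiv (by simp)).comp hγc).clm_apply continuous_const)
    exact (continuous_const.mul (h1 a ha)).add (continuous_const.mul (h1 b hb))
  have hmc : Continuous m := by
    have h1 : Continuous fun t => (clamp t : ℝ) := continuous_subtype_val.comp continuous_clamp
    have h2 : Continuous fun t => h (clamp t) := h.continuous.comp continuous_clamp
    fun_prop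
  have hu' : u = primitive (p 1 • a.comp (leafCurve (p, u)) + p 2 • b.comp (leafCurve (p, u))) := by
    rw [map_add, map_smul, map_smul]
    exact sub_eq_zero.1 hu
  rw [fderiv_leafDefect ha hb, sub_eq_zero] at hh
  have hud {t : ℝ} (ht : t ∈ Ico (0 : ℝ) 1) :
      HasDerivWithinAt (fun t => u (clamp t)) (g t) (Ici t) t := by
    have := hasDerivWithinAt_primitive
      (p 1 • a.comp (leafCurve (p, u)) + p 2 • b.comp (leafCurve (p, u))) ht
    rw [← hu'] at this
    exact this
  have hγd {t : ℝ} (ht : t ∈ Ico (0 : ℝ) 1) : HasDerivWithinAt γ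
      (-(p - p 0 • basisVec 0) + g t • basisVec 0) (Ici t) t := by
    have := (((hasDerivWithinAt_clamp ht).smul_const (p - p 0 • basisVec 0)).const_sub p).add
      ((hud ht).smul_const (basisVec 0))
    rw [one_smul] at this
    exact this
  have hcd (c : C(R3, ℝ)) (hc : ContDiff ℝ (⊤ : ℕ∞) c) {t : ℝ} (ht : t ∈ Ico (0 : ℝ) 1) :
      HasDerivWithinAt (fun t => c (γ t))
        (g t * pd 0 c (γ t) - p 1 * pd 1 c (γ t) - p 2 * pd 2 c (γ t)) (Ici t) t := by
    refine HasDerivWithinAt.congr_deriv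
      ((hc.differentiable (by simp) (γ t)).hasFDerivAt.comp_hasDerivWithinAt t (hγd ht)) ?_
    rw [fderiv_apply_eq_pd]
    simp [basisVec]
    ring
  have hhd {t : ℝ} (ht : t ∈ Ico (0 : ℝ) 1) : HasDerivWithinAt (fun t => h (clamp t))
      (f t + p 1 * fderiv ℝ a (γ t) (leafCurve (ξ, h) (clamp t)) +
        p 2 * fderiv ℝ b (γ t) (leafCurve (ξ, h) (clamp t))) (Ici t) t := by
    have := hasDerivWithinAt_primitive (ξ 1 • a.comp (leafCurve (p, u)) +
      ξ 2 • b.comp (leafCurve (p, u)) +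
      p 1 • ptApply I R3 ℝ ((contFDeriv a ha).comp (leafCurve (p, u))) (leafCurve (ξ, h)) +
      p 2 • ptApply I R3 ℝ ((contFDeriv b hb).comp (leafCurve (p, u))) (leafCurve (ξ, h))) ht
    rw [← hh] at this
    exact this
  have hmd : ∀ t ∈ Ico (0 : ℝ) 1, HasDerivWithinAt m (l t * m t) (Ici t) t := by
    intro t ht
    have h1 := ((hhd ht).add_const (ξ 0)).add (((hasDerivWithinAt_clamp ht).const_sub 1).mul
      (((hcd a ha ht).const_mul (ξ 1)).add ((hcd b hb ht).const_mul (ξ 2))))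
    refine HasDerivWithinAt.congr_deriv h1 ?_
    have hint' : pd 1 b (γ t) - a (γ t) * pd 0 b (γ t) = pd 2 a (γ t) - b (γ t) * pd 0 a (γ t) :=
      hint (clamp t)
    simp only [fderiv_apply_eq_pd, leafCurve_apply_zero, leafCurve_apply_one, leafCurve_apply_two,
      hm, hl, hf, hg, Pi.add_apply]
    linear_combination (1 - (clamp t : ℝ)) * (p 2 * ξ 1 - p 1 * ξ 2) * hint'
  have hm0 : m 0 = 0 := by
    have hu0 : u (clamp 0) = 0 := by rw [hu', primitive_apply_clamp_zero]
    have hh0 : h (clamp 0) = 0 :=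
      (DFunLike.congr_fun hh (clamp 0)).trans (primitive_apply_clamp_zero _)
    have hγ0 : γ 0 = p := by
      simp only [hγ, leafCurve_apply, hu0]
      simp [clamp]
    simp only [hm, hf, hh0, hγ0, hξ]
    simp [clamp]
  obtain ⟨K, hK⟩ := isCompact_Icc.exists_bound_of_continuousOn (hlc.continuousOn (s := Icc 0 1))
  have hm1 := eq_zero_of_abs_deriv_le_mul_abs_self_of_eq_zero_right (K := K) hmc.continuousOn hmd hm0
    (fun t ht => by
      rw [norm_mul]
      exact mul_le_mul_of_nonneg_right (hK t ⟨ht.1, ht.2.le⟩) (norm_nonneg _))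
    1 ⟨zero_le_one, le_rfl⟩
  have hc1 : clamp 1 = 1 := by simp [clamp]
  simp only [hm, hc1] at hm1
  simp at hm1
  linarith

/-- Local Frobenius theorem: if `∂_y - a ∂_x` and `∂_z - b ∂_x` commute near the origin, they admit
a common first integral there which is regular in the direction of `x`. -/
theorem exists_first_integral {a b : R3 → ℝ} (ha : ContDiff ℝ (⊤ : ℕ∞) a)
    (hb : ContDiff ℝ (⊤ : ℕ∞) b)
    (hint : ∀ᶠ p in 𝓝 0, pd 1 b p - a p * pd 0 b p = pd 2 a p - b p * pd 0 a p) :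
    ∃ v : R3 → ℝ, ∀ᶠ p in 𝓝 0, ContDiffAt ℝ (⊤ : ℕ∞) v p ∧ pd 0 v p ≠ 0 ∧
      pd 1 v p = a p * pd 0 v p ∧ pd 2 v p = b p * pd 0 v p := by
  lift a to C(R3, ℝ) using ha.continuous
  lift b to C(R3, ℝ) using hb.continuous
  have htop : ((⊤ : ℕ∞) : WithTop ℕ∞) ≠ 0 := by simp
  have hΦ := contDiff_leafDefect ha hb
  obtain ⟨ψ, hψ0, hψ⟩ := exists_implicit_of_fderiv_inr_eq_id hΦ (leafDefect_zero a b)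
    (fun h => by simp [fderiv_leafDefect ha hb])
  set v : R3 → ℝ := fun p => p 0 + ψ p 1 with hv
  have hvs {p : R3} (h : ContDiffAt ℝ (⊤ : ℕ∞) ψ p) : ContDiffAt ℝ (⊤ : ℕ∞) v p :=
    (contDiff_coord 0).contDiffAt.add
      ((ContinuousMap.evalCLM ℝ (1 : I) : C(I, ℝ) →L[ℝ] ℝ).contDiff.contDiffAt.comp p h)
  have hvd {p : R3} (h : ContDiffAt ℝ (⊤ : ℕ∞) ψ p) (ξ : R3) :
      fderiv ℝ v p ξ = ξ 0 + fderiv ℝ ψ p ξ 1 := by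
    have h1 : HasFDerivAt v _ p := (hasFDerivAt_coord 0 p).add
      ((ContinuousMap.evalCLM ℝ (1 : I) : C(I, ℝ) →L[ℝ] ℝ).hasFDerivAt.comp p
        (h.differentiableAt htop).hasFDerivAt)
    rw [h1.fderiv]
    rfl
  have hlin {p : R3} (h : ∀ᶠ p in 𝓝 p, ContDiffAt ℝ (⊤ : ℕ∞) ψ p ∧ leafDefect a b (p, ψ p) = 0)
      (ξ : R3) : fderiv ℝ (leafDefect a b) (p, ψ p) (ξ, fderiv ℝ ψ p ξ) = 0 := by
    have h1 := (hΦ.differentiable htop (p, ψ p)).hasFDerivAt.comp p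
      ((hasFDerivAt_id p).prodMk (h.self_of_nhds.1.differentiableAt htop).hasFDerivAt)
    have h2 : HasFDerivAt (leafDefect a b ∘ fun p => (p, ψ p)) (0 : R3 →L[ℝ] C(I, ℝ)) p :=
      (hasFDerivAt_const (0 : C(I, ℝ)) p).congr_of_eventuallyEq (h.mono fun q hq => hq.2)
    exact DFunLike.congr_fun (h1.unique h2) ξ
  have hψc : ContinuousAt ψ 0 := hψ.self_of_nhds.1.continuousAt
  have hint' : ∀ᶠ p in 𝓝 (0 : R3), ∀ s, pd 1 b (leafCurve (p, ψ p) s) -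
        a (leafCurve (p, ψ p) s) * pd 0 b (leafCurve (p, ψ p) s) =
      pd 2 a (leafCurve (p, ψ p) s) - b (leafCurve (p, ψ p) s) * pd 0 a (leafCurve (p, ψ p) s) := by
    obtain ⟨ε, hε, hball⟩ := Metric.eventually_nhds_iff.1 hint
    have hc : ContinuousAt (fun p => leafCurve (p, ψ p)) 0 :=
      leafCurve.continuous.continuousAt.comp (continuousAt_id.prodMk hψc)
    have h0 : leafCurve ((0 : R3), ψ 0) = 0 := by rw [hψ0]; exact map_zero leafCurve
    have := hc.eventually (Metric.ball_mem_nhds _ hε)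
    filter_upwards [this] with p hp s
    simp only [h0] at hp
    rw [dist_zero_right] at hp
    exact hball (by rw [dist_zero_right]; exact ((leafCurve (p, ψ p)).norm_coe_le_norm s).trans_lt hp)
  have hv0 : pd 0 v 0 ≠ 0 := by
    have h1 := hlin hψ (basisVec 0)
    rw [fderiv_leafDefect ha hb, sub_eq_zero] at h1
    rw [pd, hvd hψ.self_of_nhds.1, h1]
    simp
  have hvc : ContinuousAt (pd 0 v) 0 :=
    (((hvs hψ.self_of_nhds.1).fderiv_right (m := 0) (by simp)).continuousAt).clm_apply
      continuousAt_const
  refine ⟨v, ?_⟩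
  filter_upwards [hψ.eventually_nhds, hint', hvc.eventually_ne hv0] with p hp hi hne
  have hp1 := hp.self_of_nhds
  have key (ξ : R3) (hξ : ξ 0 = -(ξ 1 * a p + ξ 2 * b p)) : fderiv ℝ v p ξ = 0 := by
    rw [hvd hp1.1, endpoint_variation_eq ha hb hp1.2 (hlin hp ξ) hξ hi, add_neg_cancel]
  refine ⟨hvs hp1.1, hne, ?_, ?_⟩
  · have := key (basisVec 1 - a p • basisVec 0) (by simp [basisVec])
    rw [map_sub, map_smul, smul_eq_mul] at this
    exact sub_eq_zero.1 this
  · have := key (basisVec 2 - b p • basisVec 0) (by simp [basisVec])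
    rw [map_sub, map_smul, smul_eq_mul] at this
    exact sub_eq_zero.1 this

end LeafCurves

section Backlund

theorem exists_contDiff_eventuallyEq {f : R3 → ℝ} {U : Set R3} (hU : IsOpen U)
    (h0 : (0 : R3) ∈ U) (hf : ContDiffOn ℝ (⊤ : ℕ∞) f U) :
    ∃ g : R3 → ℝ, ContDiff ℝ (⊤ : ℕ∞) g ∧ g =ᶠ[𝓝 0] f := by
  obtain ⟨r, hr, hrU⟩ := Metric.nhds_basis_closedBall.mem_iff.1 (hU.mem_nhds h0)
  let χ : ContDiffBump (0 : R3) := ⟨r / 2, r, by positivity, by linarith⟩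
  refine ⟨fun p => χ p * f p, contDiff_iff_contDiffAt.2 fun p => ?_, ?_⟩
  · by_cases hp : p ∈ tsupport χ
    · have hpU : p ∈ U := hrU (by rwa [χ.tsupport_eq] at hp)
      exact χ.contDiff.contDiffAt.mul (hf.contDiffAt (hU.mem_nhds hpU))
    · have h1 : (fun p => χ p * f p) =ᶠ[𝓝 p] fun _ => 0 := by
        filter_upwards [notMem_tsupport_iff_eventuallyEq.1 hp] with q hq
        simp [hq]
      exact contDiffAt_const.congr_of_eventuallyEq h1
  · filter_upwards [χ.eventuallyEq_one] with p hp
    simp [hp]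

theorem ContDiffOn.pd {f : R3 → ℝ} {U : Set R3} (hU : IsOpen U) (hf : ContDiffOn ℝ (⊤ : ℕ∞) f U)
    (i : Fin 3) : ContDiffOn ℝ (⊤ : ℕ∞) (pd i f) U :=
  (hf.fderiv_of_isOpen hU (by simp)).clm_apply contDiffOn_const

theorem pd_comm {f : R3 → ℝ} {p : R3} (hf : ContDiffAt ℝ (⊤ : ℕ∞) f p) (i j : Fin 3) :
    pd i (pd j f) p = pd j (pd i f) p := by
  have h1 : DifferentiableAt ℝ (fderiv ℝ f) p :=
    (hf.fderiv_right (m := 1) (by norm_cast)).differentiableAt (by simp)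
  have h2 (i j : Fin 3) : pd i (pd j f) p = fderiv ℝ (fderiv ℝ f) p (basisVec i) (basisVec j) := by
    have := h1.hasFDerivAt.clm_apply (hasFDerivAt_const (basisVec j) p)
    change fderiv ℝ (fun q => fderiv ℝ f q (basisVec j)) p (basisVec i) = _
    rw [this.fderiv]
    simp
  rw [h2, h2]
  exact hf.isSymmSndFDerivAt (by simp; norm_cast) _ _

theorem pd_mul_eq_of_eventually {f g h : R3 → ℝ} {k : ℝ} {p : R3} (hf : DifferentiableAt ℝ f p)
    (hg : DifferentiableAt ℝ g p) (hh : DifferentiableAt ℝ h p)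
    (heq : ∀ᶠ q in 𝓝 p, f q * g q = k * h q) (i : Fin 3) :
    pd i f p * g p + f p * pd i g p = k * pd i h p := by
  have h1 : HasFDerivAt (fun q => f q * g q) _ p := hf.hasFDerivAt.mul hg.hasFDerivAt
  have h2 := (hh.hasFDerivAt.const_mul k).congr_of_eventuallyEq heq
  have := DFunLike.congr_fun (h1.unique h2) (basisVec i)
  simp only [add_apply, smul_apply, smul_eq_mul] at this
  simp only [pd]
  linear_combination this

end Backlund

/-- Theorem 5.50, part 4: a nondegenerate smooth solution `w` of the
(A,B,C)-equation admits, near the origin, a nondegenerate Bäcklund–Darboux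
partner `v`; in particular `v` solves the (A',B',C')-equation. -/
theorem exists_backlund_partner
    (A B C A' B' C' : ℝ) (hABC : Admissible A B C) (hABC' : Admissible A' B' C')
    (hne : A * B' ≠ A' * B)
    (U : Set R3) (hU : IsOpen U) (h0 : (0 : R3) ∈ U)
    (w : R3 → ℝ) (hw : ContDiffOn ℝ (⊤ : ℕ∞) w U) (hwn : Nondeg w U)
    (hweq : ABCEq A B C w U) :
    ∃ V : Set R3, IsOpen V ∧ (0 : R3) ∈ V ∧ V ⊆ U ∧
      ∃ v : R3 → ℝ, ContDiffOn ℝ (⊤ : ℕ∞) v V ∧ Nondeg v V ∧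
        Backlund A B C A' B' C' w v V ∧ ABCEq A' B' C' v V := by
  obtain ⟨hA, hB, hC, hsum⟩ := hABC
  obtain ⟨hA', hB', hC', hsum'⟩ := hABC'
  obtain ⟨μ, hμ⟩ : ∃ μ, A * B' * μ = A' * B := ⟨A' * B / (A * B'), by field_simp⟩
  obtain ⟨ν, hν⟩ : ∃ ν, A * C' * ν = A' * C := ⟨A' * C / (A * C'), by field_simp⟩
  have hμ0 : μ ≠ 0 := by
    rintro rfl
    exact mul_ne_zero hA' hB (by linarith)
  have hν0 : ν ≠ 0 := by
    rintro rfl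
    exact mul_ne_zero hA' hC (by linarith)
  have hμν : A * (μ - μ * ν) = (ν - μ) * B := by
    refine mul_left_cancel₀ (mul_ne_zero (mul_ne_zero hA hB') (mul_ne_zero hA hC')) ?_
    linear_combination (A * A * C' - A * (A * C' * ν) + B * A * C') * hμ
      - (A * A' * B + B * A * B') * hν + A * A' * B * (C' * hsum - C * hsum')
  have hνμ : A * (μ * ν - ν) = (ν - μ) * C := by
    linear_combination -hμν - (ν - μ) * hsum
  set α : R3 → ℝ := fun p => μ * pd 1 w p / pd 0 w p with hα
  set β : R3 → ℝ := fun p => ν * pd 2 w p / pd 0 w p with hβ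
  have hws (i : Fin 3) : ContDiffOn ℝ (⊤ : ℕ∞) (pd i w) U := hw.pd hU i
  have hαs : ContDiffOn ℝ (⊤ : ℕ∞) α U :=
    (contDiffOn_const.mul (hws 1)).div (hws 0) fun p hp => (hwn p hp).1
  have hβs : ContDiffOn ℝ (⊤ : ℕ∞) β U :=
    (contDiffOn_const.mul (hws 2)).div (hws 0) fun p hp => (hwn p hp).1
  have hdiff {f : R3 → ℝ} (hf : ContDiffOn ℝ (⊤ : ℕ∞) f U) {p : R3} (hp : p ∈ U) :
      DifferentiableAt ℝ f p := (hf.contDiffAt (hU.mem_nhds hp)).differentiableAt (by simp)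
  have hαX {p : R3} (hp : p ∈ U) : α p * pd 0 w p = μ * pd 1 w p :=
    div_mul_cancel₀ _ (hwn p hp).1
  have hβX {p : R3} (hp : p ∈ U) : β p * pd 0 w p = ν * pd 2 w p :=
    div_mul_cancel₀ _ (hwn p hp).1
  have hαd {p : R3} (hp : p ∈ U) := pd_mul_eq_of_eventually (hdiff hαs hp) (hdiff (hws 0) hp)
    (hdiff (hws 1) hp) ((hU.eventually_mem hp).mono fun q hq => hαX hq)
  have hβd {p : R3} (hp : p ∈ U) := pd_mul_eq_of_eventually (hdiff hβs hp) (hdiff (hws 0) hp)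
    (hdiff (hws 2) hp) ((hU.eventually_mem hp).mono fun q hq => hβX hq)
  have hcomm {p : R3} (hp : p ∈ U) (i j : Fin 3) : pd i (pd j w) p = pd j (pd i w) p :=
    pd_comm (hw.contDiffAt (hU.mem_nhds hp)) i j
  have hint {p : R3} (hp : p ∈ U) :
      pd 1 β p - α p * pd 0 β p = pd 2 α p - β p * pd 0 α p := by
    have hX := (hwn p hp).1
    have e1 := hαX hp
    have e2 := hβX hp
    have e3 := hαd hp 0
    have e4 := hαd hp 2
    have e5 := hβd hp 0
    have e6 := hβd hp 1
    have e := hweq p hp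
    rw [hcomm hp 2 1, hcomm hp 2 0] at e4
    rw [hcomm hp 1 0] at e6
    refine mul_left_cancel₀ (mul_ne_zero hA (pow_ne_zero 2 hX)) ?_
    linear_combination A * (pd 0 w p * e6 - pd 0 (pd 1 w) p * e2 - α p * pd 0 w p * e5
      - ν * pd 0 (pd 2 w) p * e1 - pd 0 w p * e4 + pd 0 (pd 2 w) p * e1 + β p * pd 0 w p * e3
      + μ * pd 0 (pd 1 w) p * e2) + pd 1 w p * pd 0 (pd 2 w) p * hμν
      + pd 2 w p * pd 0 (pd 1 w) p * hνμ + (ν - μ) * e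
  have hαβ {p : R3} (hp : p ∈ U) : C' * pd 1 β p + B' * pd 2 α p = 0 := by
    have hX := (hwn p hp).1
    have e1 := hαX hp
    have e2 := hβX hp
    have e4 := hαd hp 2
    have e6 := hβd hp 1
    have e := hweq p hp
    rw [hcomm hp 2 1, hcomm hp 2 0] at e4
    rw [hcomm hp 1 0] at e6
    refine (mul_eq_zero.1 ?_).resolve_left (mul_ne_zero hA (pow_ne_zero 2 hX))
    linear_combination A * C' * (pd 0 w p * e6 - pd 0 (pd 1 w) p * e2)
      + A * B' * (pd 0 w p * e4 - pd 0 (pd 2 w) p * e1)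
      + (pd 0 w p * pd 1 (pd 2 w) p - pd 2 w p * pd 0 (pd 1 w) p) * hν
      + (pd 0 w p * pd 1 (pd 2 w) p - pd 1 w p * pd 0 (pd 2 w) p) * hμ
      - A' * e + A' * pd 0 w p * pd 1 (pd 2 w) p * hsum
  obtain ⟨a, ha, haα⟩ := exists_contDiff_eventuallyEq hU h0 hαs
  obtain ⟨b, hb, hbβ⟩ := exists_contDiff_eventuallyEq hU h0 hβs
  have hpd {f g : R3 → ℝ} {p : R3} (h : f =ᶠ[𝓝 p] g) (i : Fin 3) : pd i f p = pd i g p := by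
    rw [pd, pd, h.fderiv_eq]
  obtain ⟨v, hv⟩ := exists_first_integral ha hb (by
    filter_upwards [haα.eventuallyEq_nhds, hbβ.eventuallyEq_nhds, hU.eventually_mem h0]
      with p h1 h2 hp
    rw [hpd h1, hpd h1, hpd h2, hpd h2, h1.self_of_nhds, h2.self_of_nhds, hint hp])
  have hall : ∀ᶠ p in 𝓝 (0 : R3), p ∈ U ∧ ContDiffAt ℝ (⊤ : ℕ∞) v p ∧ pd 0 v p ≠ 0 ∧
      α p * pd 0 v p = 1 * pd 1 v p ∧ β p * pd 0 v p = 1 * pd 2 v p := by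
    filter_upwards [haα, hbβ, hU.eventually_mem h0, hv] with p h1 h2 hp h3
    exact ⟨hp, h3.1, h3.2.1, by rw [← h1, one_mul, h3.2.2.1], by rw [← h2, one_mul, h3.2.2.2]⟩
  obtain ⟨V, hVp, hV, h0V⟩ := eventually_nhds_iff.1 hall
  have hvs : ContDiffOn ℝ (⊤ : ℕ∞) v V := fun p hp => (hVp p hp).2.1.contDiffWithinAt
  refine ⟨V, hV, h0V, fun p hp => (hVp p hp).1, v, hvs, fun p hp => ?_, fun p hp => ?_,
    fun p hp => ?_⟩
  · obtain ⟨hpU, -, hvx, h1, h2⟩ := hVp p hp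
    obtain ⟨hX, hY, hZ⟩ := hwn p hpU
    rw [one_mul] at h1 h2
    exact ⟨hvx, h1 ▸ mul_ne_zero (div_ne_zero (mul_ne_zero hμ0 hY) hX) hvx,
      h2 ▸ mul_ne_zero (div_ne_zero (mul_ne_zero hν0 hZ) hX) hvx⟩
  · obtain ⟨hpU, -, -, h1, h2⟩ := hVp p hp
    constructor
    · linear_combination -A * B' * pd 0 w p * h1 + A * B' * pd 0 v p * hαX hpU
        + pd 1 w p * pd 0 v p * hμ
    · linear_combination -A * C' * pd 0 w p * h2 + A * C' * pd 0 v p * hβX hpU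
        + pd 2 w p * pd 0 v p * hν
  · obtain ⟨hpU, hvp, -, h1, h2⟩ := hVp p hp
    have hvd (i : Fin 3) : DifferentiableAt ℝ (pd i v) p :=
      ((hvs.pd hV i).contDiffAt (hV.mem_nhds hp)).differentiableAt (by simp)
    have e1 := pd_mul_eq_of_eventually (hdiff hαs hpU) (hvd 0) (hvd 1)
      ((hV.eventually_mem hp).mono fun q hq => (hVp q hq).2.2.2.1) 2
    have e2 := pd_mul_eq_of_eventually (hdiff hβs hpU) (hvd 0) (hvd 2)
      ((hV.eventually_mem hp).mono fun q hq => (hVp q hq).2.2.2.2) 1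
    rw [pd_comm hvp 2 1, pd_comm hvp 2 0] at e1
    rw [pd_comm hvp 1 0] at e2
    linear_combination pd 0 v p * (C' * e2 + B' * e1) - B' * pd 0 (pd 2 v) p * h1
      - C' * pd 0 (pd 1 v) p * h2 - pd 0 v p ^ 2 * hαβ hpU
      + pd 0 v p * pd 1 (pd 2 v) p * hsum'
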